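/- A field K admits an ordering if and only if -1 is not a sum of squares in K, which holds if and only if for all n ∈ ℕ and a₁,...,aₙ ∈ K, a₁² + ... + aₙ² = 0 implies a₁ = 0. -/

import Mathlib

/-- An ordering (positive cone) of a field `K`. -/
def IsOrdering {K : Type*} [Field K] (P : Set K) : Prop :=
  (∀ a ∈ P, ∀ b ∈ P, a + b ∈ P) ∧ (∀ a ∈ P, ∀ b ∈ P, a * b ∈ P) ∧
    (∀ a : K, a ∈ P ∨ -a ∈ P) ∧ (∀ a : K, a ∈ P → -a ∈ P → a = 0)

theorem isSumSq_iff_exists_fin_sum_sq {R : Type*} [CommSemiring R] {s : R} :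
    IsSumSq s ↔ ∃ (n : ℕ) (a : Fin n → R), s = ∑ i, a i ^ 2 := by
  constructor
  · intro h
    induction h with
    | zero => exact ⟨0, Fin.elim0, by simp⟩
    | sq_add b _ ih =>
      obtain ⟨n, a, rfl⟩ := ih
      exact ⟨n + 1, Fin.cons b a, by simp [Fin.sum_univ_succ, sq]⟩
  · rintro ⟨n, a, rfl⟩
    exact IsSumSq.sum_sq _ _

namespace RingPreordering

theorem bddAbove_of_isChain {R : Type*} [CommRing R] {c : Set (RingPreordering R)}
    (hc : IsChain (· ≤ ·) c) (hne : c.Nonempty) : BddAbove c := by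
  obtain ⟨Q, hQ⟩ := hne
  have common {x y : R} (hx : ∃ P ∈ c, x ∈ P) (hy : ∃ P ∈ c, y ∈ P) :
      ∃ P ∈ c, x ∈ P ∧ y ∈ P := by
    obtain ⟨P₁, h₁, hx⟩ := hx
    obtain ⟨P₂, h₂, hy⟩ := hy
    rcases hc.total h₁ h₂ with h | h
    · exact ⟨P₂, h₂, h hx, hy⟩
    · exact ⟨P₁, h₁, hx, h hy⟩
  refine ⟨RingPreordering.mk' {x | ∃ P ∈ c, x ∈ P} ?_ ?_ ?_ ?_, fun P hP x hx => ⟨P, hP, hx⟩⟩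
  · intro x y hx hy
    obtain ⟨P, hP, hx, hy⟩ := common hx hy
    exact ⟨P, hP, add_mem hx hy⟩
  · intro x y hx hy
    obtain ⟨P, hP, hx, hy⟩ := common hx hy
    exact ⟨P, hP, mul_mem hx hy⟩
  · exact fun x => ⟨Q, hQ, Q.mul_self_mem x⟩
  · rintro ⟨P, -, h⟩
    exact P.neg_one_notMem h

variable {F : Type*} [Field F]

theorem exists_le_mem_of_neg_notMem (P : RingPreordering F) {x : F} (hx : -x ∉ P) :
    ∃ Q : RingPreordering F, P ≤ Q ∧ x ∈ Q := by
  refine ⟨RingPreordering.mk' {y | ∃ a ∈ P, ∃ b ∈ P, y = a + x * b} ?_ ?_ ?_ ?_,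
    fun a ha => ⟨a, ha, 0, zero_mem P, by ring⟩, ⟨0, zero_mem P, 1, one_mem P, by ring⟩⟩
  · rintro _ _ ⟨a, ha, b, hb, rfl⟩ ⟨a', ha', b', hb', rfl⟩
    exact ⟨a + a', add_mem ha ha', b + b', add_mem hb hb', by ring⟩
  · rintro _ _ ⟨a, ha, b, hb, rfl⟩ ⟨a', ha', b', hb', rfl⟩
    exact ⟨a * a' + x * x * (b * b'),
      add_mem (mul_mem ha ha') (mul_mem (P.mul_self_mem x) (mul_mem hb hb')),
      a * b' + b * a', add_mem (mul_mem ha hb') (mul_mem hb ha'), by ring⟩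
  · exact fun y => ⟨y * y, P.mul_self_mem y, 0, zero_mem P, by ring⟩
  · rintro ⟨a, ha, b, hb, h⟩
    have hb0 : b ≠ 0 := by
      rintro rfl
      exact P.neg_one_notMem (by simpa [h] using ha)
    apply hx
    have key : -x = (1 + a) * b⁻¹ := by
      field_simp
      linear_combination h
    rw [key]
    exact mul_mem (add_mem (one_mem P) ha) (P.inv_mem hb)

theorem mem_or_neg_mem_of_isMax {P : RingPreordering F} (hP : IsMax P) (x : F) :
    x ∈ P ∨ -x ∈ P := by
  by_contra! h
  obtain ⟨Q, hPQ, hxQ⟩ := P.exists_le_mem_of_neg_notMem h.2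
  exact h.1 (hP hPQ hxQ)

theorem isOrdering_of_isMax {P : RingPreordering F} (hP : IsMax P) :
    _root_.IsOrdering (P : Set F) :=
  ⟨fun _ ha _ hb => add_mem ha hb, fun _ ha _ hb => mul_mem ha hb,
    mem_or_neg_mem_of_isMax hP, fun _ => P.eq_zero_of_mem_of_neg_mem⟩

end RingPreordering

namespace IsOrdering

variable {K : Type*} [Field K] {P : Set K}

theorem mul_self_mem (hP : IsOrdering P) (x : K) : x * x ∈ P := by
  obtain ⟨-, mul, total, -⟩ := hP
  rcases total x with h | h
  · exact mul x h x h
  · simpa using mul _ h _ h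

theorem mem_of_isSumSq (hP : IsOrdering P) {s : K} (hs : IsSumSq s) : s ∈ P := by
  induction hs with
  | zero => simpa using hP.mul_self_mem 0
  | sq_add a _ ih => exact hP.1 _ (hP.mul_self_mem a) _ ih

theorem not_isSumSq_neg_one (hP : IsOrdering P) : ¬ IsSumSq (-1 : K) := fun h =>
  one_ne_zero (hP.2.2.2 1 (hP.mem_of_isSumSq IsSumSq.one) (hP.mem_of_isSumSq h))

end IsOrdering

theorem exists_isOrdering_iff_not_isSumSq_neg_one {K : Type*} [Field K] :
    (∃ P : Set K, IsOrdering P) ↔ ¬ IsSumSq (-1 : K) := by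
  refine ⟨fun ⟨P, hP⟩ => hP.not_isSumSq_neg_one, fun h => ?_⟩
  have : Nonempty (RingPreordering K) :=
    ⟨RingPreordering.mk' {s | IsSumSq s} IsSumSq.add IsSumSq.mul IsSumSq.mul_self h⟩
  obtain ⟨P, hP⟩ := zorn_le_nonempty (α := RingPreordering K)
    fun c hc hne => RingPreordering.bddAbove_of_isChain hc hne
  exact ⟨P, RingPreordering.isOrdering_of_isMax hP⟩

/-- A field admits an ordering iff `-1` is not a sum of squares, which holds iff
every vanishing sum of squares has vanishing first term. -/
theorem stmt1 {K : Type*} [Field K] :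
    ((∃ P : Set K, IsOrdering P) ↔
      ¬ ∃ (n : ℕ) (a : Fin n → K), (-1 : K) = ∑ i, a i ^ 2) ∧
    ((¬ ∃ (n : ℕ) (a : Fin n → K), (-1 : K) = ∑ i, a i ^ 2) ↔
      ∀ (n : ℕ) (a : Fin (n + 1) → K), ∑ i, a i ^ 2 = 0 → a 0 = 0) := by
  constructor
  · rw [← isSumSq_iff_exists_fin_sum_sq]
    exact exists_isOrdering_iff_not_isSumSq_neg_one
  · constructor
    · intro h n a ha
      by_contra h0
      refine h ⟨n, fun i => a i.succ / a 0, ?_⟩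
      rw [Fin.sum_univ_succ] at ha
      simp_rw [div_pow]
      rw [← Finset.sum_div, eq_div_iff (pow_ne_zero 2 h0)]
      linear_combination -ha
    · rintro h ⟨n, a, ha⟩
      have := h n (Fin.cons 1 a) (by simp [Fin.sum_univ_succ, ← ha])
      simp at this
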